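/- Every recursively squeezable subset of a compact metrizable space is squeezable. -/

import Mathlib

open Metric Set Function

universe u v

/-- A collection of subsets of a (pseudo)metric space is *null* if for every `ε > 0`
only finitely many of its members have diameter `≥ ε`. -/
def IsNullCollection {X : Type u} [PseudoMetricSpace X] (𝒞 : Set (Set X)) : Prop :=
  ∀ ε : ℝ, 0 < ε → {C | C ∈ 𝒞 ∧ ε ≤ Metric.diam C}.Finite

/-- An upper semi-continuous decomposition of a space `X`: a partition of `X` into
nonempty compact subsets such that the quotient map to the quotient space
(with the quotient topology) is a closed map. -/
def IsUSCDecomposition {X : Type u} [TopologicalSpace X] (𝒢 : Set (Set X)) : Prop :=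
  (∀ G ∈ 𝒢, IsCompact G ∧ G.Nonempty) ∧
  (∀ x : X, ∃! G, G ∈ 𝒢 ∧ x ∈ G) ∧
  IsClosedMap (Quot.mk (fun x y : X => ∃ G ∈ 𝒢, x ∈ G ∧ y ∈ G))

/-- `f` maps `S` homeomorphically onto `T`. -/
def MapsHomeomorphicallyOnto {X : Type u} {Y : Type v} [TopologicalSpace X]
    [TopologicalSpace Y] (f : X → Y) (S : Set X) (T : Set Y) : Prop :=
  ∃ e : S ≃ₜ T, ∀ x : S, (e x : Y) = f (x : X)

/-- A compact subset `A` of a metric space `X` is *squeezable* if for every null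
upper semi-continuous decomposition `𝒢` of `X` with `A ∈ 𝒢`, every open neighborhood
`U` of `A` and every `δ > 0`, there is a homeomorphism `h : X → X` which is the identity
on `X − U`, with `diam (h '' A) < δ`, and such that for every `G ∈ 𝒢` either
`diam (h '' G) < δ` or `h` is the identity on `G`. -/
def Squeezable {X : Type u} [MetricSpace X] (A : Set X) : Prop :=
  IsCompact A ∧
    ∀ 𝒢 : Set (Set X), IsUSCDecomposition 𝒢 → IsNullCollection 𝒢 → A ∈ 𝒢 →
      ∀ U : Set X, IsOpen U → A ⊆ U → ∀ δ : ℝ, 0 < δ →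
        ∃ h : X ≃ₜ X, (∀ x ∈ Uᶜ, h x = x) ∧ Metric.diam (⇑h '' A) < δ ∧
          ∀ G ∈ 𝒢, Metric.diam (⇑h '' G) < δ ∨ ∀ x ∈ G, h x = x

/-- A compact subset `A` of a metric space `X` is *squashable* if for every null
upper semi-continuous decomposition `𝒢` of `X` with `A ∈ 𝒢`, every open neighborhood `U`
of `A` and every `δ > 0`, there is a continuous map `f : X → X` in the closure (in `C(X,X)`)
of the set of homeomorphisms of `X` fixing `X − U` pointwise, such that `f '' A` is a
one-point set `{p}`, `f` maps `X − A` homeomorphically onto `X − {p}`, and for every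
`G ∈ 𝒢` either `diam (f '' G) < δ` or `f` is the identity on `G`. -/
def Squashable {X : Type u} [MetricSpace X] (A : Set X) : Prop :=
  IsCompact A ∧
    ∀ 𝒢 : Set (Set X), IsUSCDecomposition 𝒢 → IsNullCollection 𝒢 → A ∈ 𝒢 →
      ∀ U : Set X, IsOpen U → A ⊆ U → ∀ δ : ℝ, 0 < δ →
        ∃ (f : C(X, X)) (p : X),
          f ∈ closure ((fun h : X ≃ₜ X => (h : C(X, X))) ''
              {h : X ≃ₜ X | ∀ x ∈ Uᶜ, h x = x}) ∧
          ⇑f '' A = {p} ∧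
          MapsHomeomorphicallyOnto (⇑f) Aᶜ ({p}ᶜ) ∧
          ∀ G ∈ 𝒢, Metric.diam (⇑f '' G) < δ ∨ ∀ x ∈ G, f x = x

/-- `π` injects over `C` if `π` is injective on `π ⁻¹' C`. -/
def InjectsOver {X : Type u} {Y : Type v} (π : X → Y) (C : Set Y) : Prop :=
  Set.InjOn π (π ⁻¹' C)

/-- The strong shrinking criterion for an onto map `π : X → Y` between compact metric
spaces. -/
def SatisfiesStrongShrinkingCriterion {X : Type u} {Y : Type v} [MetricSpace X]
    [MetricSpace Y] (π : X → Y) : Prop :=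
  ∀ δ : ℝ, 0 < δ → ∀ C : Set Y, IsClosed C → InjectsOver π C →
    ∃ h : X ≃ₜ X,
      (∀ y : Y, Metric.diam (⇑h '' (π ⁻¹' {y})) < δ) ∧
      (∀ x : X, dist (π x) (π (h.symm x)) < δ) ∧
      ∀ x ∈ π ⁻¹' C, h x = x

/-- `π : X → Y` is a strong near homeomorphism. -/
def IsStrongNearHomeomorphism {X : Type u} {Y : Type v} [MetricSpace X]
    [MetricSpace Y] (π : X → Y) : Prop :=
  ∀ ε : ℝ, 0 < ε → ∀ C : Set Y, IsClosed C → InjectsOver π C →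
    ∃ f : X ≃ₜ Y, (∀ x : X, dist (π x) (f x) < ε) ∧ ∀ x ∈ π ⁻¹' C, f x = π x

/-- A subset of `ℝⁿ` is starlike if it is compact and contains a point `x` such that the
segment from `x` to any of its points lies in it. -/
def IsStarlike {n : ℕ} (A : Set (EuclideanSpace ℝ (Fin n))) : Prop :=
  IsCompact A ∧ ∃ x ∈ A, ∀ y ∈ A, segment ℝ x y ⊆ A

/-- A subset `A` of a space `X` is starlike-equivalent if some open neighborhood of `A`
embeds onto an open subset of some `ℝⁿ` (`n ≥ 1`) carrying `A` onto a starlike set. -/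
def IsStarlikeEquivalent {X : Type u} [TopologicalSpace X] (A : Set X) : Prop :=
  ∃ n : ℕ, 1 ≤ n ∧ ∃ U : Set X, IsOpen U ∧ A ⊆ U ∧
    ∃ e : U → EuclideanSpace ℝ (Fin n), Topology.IsEmbedding e ∧ IsOpen (Set.range e) ∧
      IsStarlike (e '' {x : U | (x : X) ∈ A})

/-- The image `A/B` of `A` in the quotient `X/B` of `X` obtained by identifying the
compact set `B ⊆ A` to a point is a squeezable subset of `X/B`, for some
(equivalently, by metric-independence, any) metric inducing the quotient topology.
The quotient `X/B` is modelled by an arbitrary compact metric space `Y` together with a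
continuous surjection `π : X → Y` whose fibers are `B` and the singletons of `X − B`
(such a map from the compact space `X` to the metrizable space `Y` is automatically a
closed quotient map, so `Y` is `X/B` with a metric inducing the quotient topology). -/
def SqueezableInQuotient {X : Type u} [MetricSpace X] (B A : Set X) : Prop :=
  ∃ (Y : Type u) (mY : MetricSpace Y) (π : X → Y),
    letI := mY
    Continuous π ∧ Function.Surjective π ∧
      (∀ x y : X, π x = π y ↔ x = y ∨ (x ∈ B ∧ y ∈ B)) ∧ Squeezable (π '' A)

/-- `A/B` is a squashable subset of `X/B`; see `SqueezableInQuotient`. -/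
def SquashableInQuotient {X : Type u} [MetricSpace X] (B A : Set X) : Prop :=
  ∃ (Y : Type u) (mY : MetricSpace Y) (π : X → Y),
    letI := mY
    Continuous π ∧ Function.Surjective π ∧
      (∀ x y : X, π x = π y ↔ x = y ∨ (x ∈ B ∧ y ∈ B)) ∧ Squashable (π '' A)

/-- `A/B` is a starlike-equivalent subset of `X/B`; see `SqueezableInQuotient`. -/
def StarlikeEquivalentInQuotient {X : Type u} [MetricSpace X] (B A : Set X) : Prop :=
  ∃ (Y : Type u) (mY : MetricSpace Y) (π : X → Y),
    letI := mY
    Continuous π ∧ Function.Surjective π ∧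
      (∀ x y : X, π x = π y ↔ x = y ∨ (x ∈ B ∧ y ∈ B)) ∧ IsStarlikeEquivalent (π '' A)

/-- `A` is recursively squeezable of filtration length `≤ n`: there is a chain
`A₁ ⊆ ⋯ ⊆ A_{n+1} = A` of compact subsets of `X` with `A₁` squeezable in `X` and
`A_{i+1}/A_i` squeezable in `X/A_i` for each `i`. -/
def RecursivelySqueezableOfLength {X : Type u} [MetricSpace X] (n : ℕ) (A : Set X) :
    Prop :=
  ∃ F : Fin (n + 1) → Set X,
    (∀ i, IsCompact (F i)) ∧ Monotone F ∧ F (Fin.last n) = A ∧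
    Squeezable (F 0) ∧ ∀ i : Fin n, SqueezableInQuotient (F i.castSucc) (F i.succ)

/-- `A` is recursively squeezable: recursively squeezable of filtration length `≤ n`
for some `n ≥ 0`. -/
def RecursivelySqueezable {X : Type u} [MetricSpace X] (A : Set X) : Prop :=
  ∃ n : ℕ, RecursivelySqueezableOfLength n A

/-- `A` is recursively squashable of filtration length `≤ n`. -/
def RecursivelySquashableOfLength {X : Type u} [MetricSpace X] (n : ℕ) (A : Set X) :
    Prop :=
  ∃ F : Fin (n + 1) → Set X,
    (∀ i, IsCompact (F i)) ∧ Monotone F ∧ F (Fin.last n) = A ∧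
    Squashable (F 0) ∧ ∀ i : Fin n, SquashableInQuotient (F i.castSucc) (F i.succ)

/-- `A` is recursively squashable. -/
def RecursivelySquashable {X : Type u} [MetricSpace X] (A : Set X) : Prop :=
  ∃ n : ℕ, RecursivelySquashableOfLength n A

/-- `A` is recursively starlike-equivalent of filtration length `≤ n`. -/
def RecursivelyStarlikeEquivalentOfLength {X : Type u} [MetricSpace X] (n : ℕ)
    (A : Set X) : Prop :=
  ∃ F : Fin (n + 1) → Set X,
    (∀ i, IsCompact (F i)) ∧ Monotone F ∧ F (Fin.last n) = A ∧
    IsStarlikeEquivalent (F 0) ∧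
    ∀ i : Fin n, StarlikeEquivalentInQuotient (F i.castSucc) (F i.succ)

/-- `A` is recursively starlike-equivalent. -/
def RecursivelyStarlikeEquivalent {X : Type u} [MetricSpace X] (A : Set X) : Prop :=
  ∃ n : ℕ, RecursivelyStarlikeEquivalentOfLength n A

/-- A null partition of a compact metric space into nonempty compact sets is upper
semi-continuous. -/
theorem IsNullCollection.isUSCDecomposition {X : Type u} [MetricSpace X] [CompactSpace X]
    {𝒢 : Set (Set X)} (hnull : IsNullCollection 𝒢) (hcpt : ∀ G ∈ 𝒢, IsCompact G ∧ G.Nonempty)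
    (hpart : ∀ x : X, ∃! G, G ∈ 𝒢 ∧ x ∈ G) : IsUSCDecomposition 𝒢 := by
  refine ⟨hcpt, hpart, fun K hK ↦ ?_⟩
  have hequiv : Equivalence (fun x y : X => ∃ G ∈ 𝒢, x ∈ G ∧ y ∈ G) := by
    refine ⟨fun x ↦ ?_, ?_, ?_⟩
    · obtain ⟨G, ⟨hG, hx⟩, -⟩ := hpart x
      exact ⟨G, hG, hx, hx⟩
    · rintro x y ⟨G, hG, hx, hy⟩
      exact ⟨G, hG, hy, hx⟩
    · rintro x y z ⟨G, hG, hx, hy⟩ ⟨H, hH, hy', hz⟩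
      obtain rfl := (hpart y).unique ⟨hG, hy⟩ ⟨hH, hy'⟩
      exact ⟨G, hG, hx, hz⟩
  have hsat : Quot.mk (fun x y : X => ∃ G ∈ 𝒢, x ∈ G ∧ y ∈ G) ⁻¹'
      (Quot.mk (fun x y : X => ∃ G ∈ 𝒢, x ∈ G ∧ y ∈ G) '' K) =
      {x | ∃ G ∈ 𝒢, x ∈ G ∧ (G ∩ K).Nonempty} := by
    ext x
    constructor
    · rintro ⟨z, hz, hzx⟩
      obtain ⟨G, hG, h1, h2⟩ := hequiv.eqvGen_iff.1 (Quot.eqvGen_exact hzx)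
      exact ⟨G, hG, h2, z, h1, hz⟩
    · rintro ⟨G, hG, hx, z, hzG, hzK⟩
      exact ⟨z, hzK, Quot.sound ⟨G, hG, hzG, hx⟩⟩
  refine isQuotientMap_quot_mk.isClosed_preimage.1 ?_
  rw [hsat]
  refine isClosed_of_closure_subset fun x hx ↦ ?_
  by_contra hxS
  have hxK : x ∉ K := by
    intro hxK
    obtain ⟨G, ⟨hG, hxG⟩, -⟩ := hpart x
    exact hxS ⟨G, hG, hxG, x, hxG, hxK⟩
  obtain ⟨r, hr, hrK⟩ := Metric.isOpen_iff.1 hK.isOpen_compl x hxK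
  have hfin := hnull (r / 2) (by positivity)
  set T : Set X := ⋃ G ∈ {G | G ∈ 𝒢 ∧ r / 2 ≤ diam G} ∩ {G | (G ∩ K).Nonempty}, G
  have hT : IsClosed T :=
    (hfin.inter_of_left _).isClosed_biUnion fun G hG ↦ (hcpt G hG.1.1).1.isClosed
  have hxT : x ∉ T := by
    intro hxT
    obtain ⟨G, hG, hxG⟩ := mem_iUnion₂.1 hxT
    exact hxS ⟨G, hG.1.1, hxG, hG.2⟩
  obtain ⟨y, ⟨hyr, hyT⟩, G, hG, hyG, z, hzG, hzK⟩ := mem_closure_iff.1 hx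
    (ball x (r / 2) ∩ Tᶜ) (isOpen_ball.inter hT.isOpen_compl)
    ⟨mem_ball_self (by positivity), hxT⟩
  by_cases hd : r / 2 ≤ diam G
  · exact hyT (mem_iUnion₂.2 ⟨G, ⟨⟨hG, hd⟩, z, hzG, hzK⟩, hyG⟩)
  · have h1 : dist z y ≤ diam G := dist_le_diam_of_mem (hcpt G hG).1.isBounded hzG hyG
    have h2 : dist y x < r / 2 := hyr
    refine hrK (a := z) ?_ hzK
    rw [mem_ball]
    linarith [dist_triangle z y x, not_le.1 hd]

/-- Squeezing a subset `B` of a member `A` of a null decomposition `𝒢`, with control on the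
other members of `𝒢`. -/
theorem Squeezable.exists_homeomorph_of_subset {X : Type u} [MetricSpace X] [CompactSpace X]
    {A B : Set X} (hB : Squeezable B) (hBA : B ⊆ A) {𝒢 : Set (Set X)}
    (hcpt : ∀ G ∈ 𝒢, IsCompact G ∧ G.Nonempty) (hpart : ∀ x : X, ∃! G, G ∈ 𝒢 ∧ x ∈ G)
    (hnull : IsNullCollection 𝒢) (hA : A ∈ 𝒢) {U : Set X} (hU : IsOpen U) (hBU : B ⊆ U)
    {δ : ℝ} (hδ : 0 < δ) :
    ∃ h : X ≃ₜ X, (∀ x ∈ Uᶜ, h x = x) ∧ diam (h '' B) < δ ∧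
      ∀ G ∈ 𝒢, G ≠ A → diam (h '' G) < δ ∨ ∀ x ∈ G, h x = x := by
  rcases B.eq_empty_or_nonempty with rfl | hne
  · exact ⟨Homeomorph.refl X, fun _ _ ↦ rfl, by simpa using hδ, fun _ _ _ ↦ Or.inr fun _ _ ↦ rfl⟩
  set ℋ : Set (Set X) := {B} ∪ (𝒢 \ {A} ∪ (fun x ↦ {x}) '' (A \ B))
  have hnull' : IsNullCollection ℋ := by
    intro ε hε
    refine ((hnull ε hε).insert B).subset ?_
    rintro C ⟨rfl | ⟨hC, -⟩ | ⟨x, -, rfl⟩, hd⟩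
    · exact mem_insert _ _
    · exact mem_insert_of_mem _ ⟨hC, hd⟩
    · simp only [diam_singleton] at hd
      exact absurd hd (not_le.2 hε)
  have hcpt' : ∀ G ∈ ℋ, IsCompact G ∧ G.Nonempty := by
    rintro C (rfl | ⟨hC, -⟩ | ⟨x, -, rfl⟩)
    · exact ⟨hB.1, hne⟩
    · exact hcpt C hC
    · exact ⟨isCompact_singleton, singleton_nonempty x⟩
  have hpart' : ∀ x : X, ∃! G, G ∈ ℋ ∧ x ∈ G := by
    have hxA : ∀ G ∈ 𝒢 \ {A}, ∀ x ∈ G, x ∉ A := fun G hG x hxG hx ↦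
      hG.2 ((hpart x).unique ⟨hG.1, hxG⟩ ⟨hA, hx⟩)
    intro x
    by_cases hx : x ∈ A
    · by_cases hxB : x ∈ B
      · refine ⟨B, ⟨Or.inl rfl, hxB⟩, ?_⟩
        rintro C ⟨rfl | hC | ⟨y, hy, rfl⟩, hxC⟩
        · rfl
        · exact absurd hx (hxA C hC x hxC)
        · obtain rfl : x = y := hxC
          exact absurd hxB hy.2
      · refine ⟨{x}, ⟨Or.inr (Or.inr ⟨x, ⟨hx, hxB⟩, rfl⟩), rfl⟩, ?_⟩
        rintro C ⟨rfl | hC | ⟨y, hy, rfl⟩, hxC⟩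
        · exact absurd hxC hxB
        · exact absurd hx (hxA C hC x hxC)
        · obtain rfl : x = y := hxC
          rfl
    · obtain ⟨G, ⟨hG, hxG⟩, huniq⟩ := hpart x
      refine ⟨G, ⟨Or.inr (Or.inl ⟨hG, fun h ↦ hx (h ▸ hxG)⟩), hxG⟩, ?_⟩
      rintro C ⟨rfl | hC | ⟨y, hy, rfl⟩, hxC⟩
      · exact absurd (hBA hxC) hx
      · exact huniq C ⟨hC.1, hxC⟩
      · obtain rfl : x = y := hxC
        exact absurd hy.1 hx
  obtain ⟨h, h1, h2, h3⟩ := hB.2 ℋ (hnull'.isUSCDecomposition hcpt' hpart') hnull'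
    (Or.inl rfl) U hU hBU δ hδ
  exact ⟨h, h1, h2, fun G hG hGA ↦ h3 G (Or.inr (Or.inl ⟨hG, hGA⟩))⟩

theorem Squeezable.exists_homeomorph_diam_lt {X : Type u} [MetricSpace X] [CompactSpace X]
    {B : Set X} (hB : Squeezable B) {U : Set X} (hU : IsOpen U) (hBU : B ⊆ U)
    {δ : ℝ} (hδ : 0 < δ) :
    ∃ h : X ≃ₜ X, (∀ x ∈ Uᶜ, h x = x) ∧ diam (h '' B) < δ := by
  rcases isEmpty_or_nonempty X with hX | hX
  · exact ⟨Homeomorph.refl X, fun _ _ ↦ rfl, by simpa [eq_empty_of_isEmpty B] using hδ⟩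
  obtain ⟨h, h1, h2, -⟩ := hB.exists_homeomorph_of_subset (𝒢 := {univ}) (subset_univ B)
    (by rintro G rfl; exact ⟨isCompact_univ, univ_nonempty⟩)
    (fun x ↦ ⟨univ, ⟨rfl, mem_univ x⟩, fun G hG ↦ hG.1⟩)
    (fun ε _ ↦ (finite_singleton univ).subset fun C hC ↦ hC.1) rfl hU hBU hδ
  exact ⟨h, h1, h2⟩

/-- A neighborhood of a compact set has image of small diameter if the set does. -/
theorem IsCompact.exists_isOpen_superset_dist_image_le {X : Type u} {Z : Type v}
    [TopologicalSpace X] [PseudoMetricSpace Z] {B : Set X} (hB : IsCompact B) {f : X → Z}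
    (hf : Continuous f) {ε : ℝ} (hε : diam (f '' B) < ε) :
    ∃ V : Set X, IsOpen V ∧ B ⊆ V ∧ ∀ x ∈ V, ∀ y ∈ V, dist (f x) (f y) ≤ ε := by
  set r : ℝ := (ε - diam (f '' B)) / 2 with hr
  have hr0 : 0 < r := by linarith
  refine ⟨f ⁻¹' thickening r (f '' B), isOpen_thickening.preimage hf, fun x hx ↦
    self_subset_thickening hr0 _ (mem_image_of_mem f hx), fun x hx y hy ↦ ?_⟩
  obtain ⟨a, ha, hxa⟩ := mem_thickening_iff.1 (mem_preimage.1 hx)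
  obtain ⟨b, hb, hyb⟩ := mem_thickening_iff.1 (mem_preimage.1 hy)
  have hab := dist_le_diam_of_mem (hB.image hf).isBounded ha hb
  rw [dist_comm] at hyb
  linarith [dist_triangle4 (f x) a b (f y)]

/-- A homeomorphism supported in a set maps that set into itself. -/
theorem Homeomorph.apply_mem_of_forall_compl {X : Type u} [TopologicalSpace X] {s : X ≃ₜ X}
    {V : Set X} (hs : ∀ x ∈ Vᶜ, s x = x) {x : X} (hx : x ∈ V) : s x ∈ V := by
  by_contra h
  exact h ((s.injective (hs _ h)).symm ▸ hx)

theorem Homeomorph.symm_apply_of_forall_compl {X : Type u} [TopologicalSpace X] {s : X ≃ₜ X}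
    {V : Set X} (hs : ∀ x ∈ Vᶜ, s x = x) : ∀ x ∈ Vᶜ, s.symm x = x :=
  fun x hx ↦ s.symm_apply_eq.2 (hs x hx).symm

section Squash

variable {X : Type u} {Y : Type v} [MetricSpace X] [CompactSpace X] [MetricSpace Y]
  {B : Set X} {π : X → Y}

/-- One step in the construction of a squash: an arbitrarily small modification near `B`,
measured both in `X` and in `X/B`, that shrinks the image of `B`. -/
theorem Squeezable.exists_shrinking_step (hB : Squeezable B) (hπ : Continuous π)
    (hπB : ∀ x ∈ B, ∀ y ∈ B, π x = π y) {W : Set X} (hW : IsOpen W) (hBW : B ⊆ W)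
    (h : X ≃ₜ X) {ε ε' : ℝ} (hε : diam (h '' B) < ε) (hε' : 0 < ε') :
    ∃ h' : X ≃ₜ X, (∀ x ∈ Wᶜ, h' x = h x) ∧ (∀ x, dist (h x) (h' x) ≤ ε) ∧
      (∀ x, dist (π (h.symm x)) (π (h'.symm x)) ≤ ε) ∧ diam (h' '' B) < ε' := by
  have hε0 : 0 < ε := diam_nonneg.trans_lt hε
  obtain ⟨V₁, hV₁, hBV₁, hd₁⟩ := hB.1.exists_isOpen_superset_dist_image_le h.continuous hε
  have hπε : diam (π '' B) < ε := by
    rwa [diam_subsingleton]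
    rintro _ ⟨x, hx, rfl⟩ _ ⟨y, hy, rfl⟩
    exact hπB x hx y hy
  obtain ⟨V₂, hV₂, hBV₂, hd₂⟩ := hB.1.exists_isOpen_superset_dist_image_le hπ hπε
  obtain ⟨ρ, hρ, hρh⟩ := Metric.uniformContinuous_iff.1
    (CompactSpace.uniformContinuous_of_continuous h.continuous) (ε' / 2) (by positivity)
  obtain ⟨s, hs, hsB⟩ := hB.exists_homeomorph_diam_lt ((hV₁.inter hV₂).inter hW)
    (subset_inter (subset_inter hBV₁ hBV₂) hBW) hρ
  refine ⟨s.trans h, fun x hx ↦ ?_, fun x ↦ ?_, fun x ↦ ?_, ?_⟩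
  · simp [hs x fun hx' ↦ hx hx'.2]
  · by_cases hx : x ∈ V₁ ∩ V₂ ∩ W
    · exact hd₁ _ hx.1.1 _ (Homeomorph.apply_mem_of_forall_compl hs hx).1.1
    · simp [hs x hx, hε0.le]
  · change dist (π (h.symm x)) (π (s.symm (h.symm x))) ≤ ε
    have hs' := Homeomorph.symm_apply_of_forall_compl hs
    by_cases hx : h.symm x ∈ V₁ ∩ V₂ ∩ W
    · exact hd₂ _ hx.1.2 _ (Homeomorph.apply_mem_of_forall_compl hs' hx).1.2
    · simp [hs' _ hx, hε0.le]
  · refine (diam_le_of_forall_dist_le (C := ε' / 2) (by positivity) ?_).trans_lt (half_lt_self hε')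
    rintro _ ⟨x, hx, rfl⟩ _ ⟨y, hy, rfl⟩
    refine (hρh (lt_of_le_of_lt ?_ hsB)).le
    exact dist_le_diam_of_mem (hB.1.image s.continuous).isBounded
      (mem_image_of_mem s hx) (mem_image_of_mem s hy)

/-- If `B` is squeezable, then `X/B` is homeomorphic to `X`, and the composition of the
quotient map with this homeomorphism is a uniform limit of homeomorphisms of `X` that agree with
a given one off a given neighborhood of `B`. -/
theorem Squeezable.exists_homeomorph_quotient [CompactSpace Y] (hB : Squeezable B)
    (hπ : Continuous π) (hsurj : Surjective π)
    (hfib : ∀ x y : X, π x = π y ↔ x = y ∨ (x ∈ B ∧ y ∈ B)) {W : Set X} (hW : IsOpen W)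
    (hBW : B ⊆ W) (h₀ : X ≃ₜ X) :
    ∃ Φ : X ≃ₜ Y, ∀ η : ℝ, 0 < η → ∃ k : X ≃ₜ X, (∀ x ∈ Wᶜ, k x = h₀ x) ∧
      ∀ x, dist (Φ.symm (π x)) (k x) < η := by
  set c : ℝ := 2 * (diam (h₀ '' B) + 1) with hc
  have hc0 : 0 < c := by
    have := diam_nonneg (s := h₀ '' B)
    positivity
  have hstep : ∀ (n : ℕ) (h : X ≃ₜ X), ∃ h' : X ≃ₜ X, diam (h '' B) < c / 2 / 2 ^ n →
      (∀ x ∈ Wᶜ, h' x = h x) ∧ (∀ x, dist (h x) (h' x) ≤ c / 2 / 2 ^ n) ∧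
      (∀ x, dist (π (h.symm x)) (π (h'.symm x)) ≤ c / 2 / 2 ^ n) ∧
      diam (h' '' B) < c / 2 / 2 ^ (n + 1) := by
    intro n h
    by_cases hd : diam (h '' B) < c / 2 / 2 ^ n
    · obtain ⟨h', hh'⟩ := hB.exists_shrinking_step hπ
        (fun x hx y hy ↦ (hfib x y).2 (Or.inr ⟨hx, hy⟩)) hW hBW h hd
        (show 0 < c / 2 / 2 ^ (n + 1) by positivity)
      exact ⟨h', fun _ ↦ hh'⟩
    · exact ⟨h, fun hd' ↦ absurd hd' hd⟩
  choose H hH using hstep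
  let u : ℕ → (X ≃ₜ X) := fun n ↦ Nat.rec h₀ (fun n h ↦ H n h) n
  have hdiam : ∀ n, diam (u n '' B) < c / 2 / 2 ^ n := by
    intro n
    induction n with
    | zero =>
      change diam (h₀ '' B) < _
      rw [hc]
      linarith
    | succ n ih => exact (hH n (u n) ih).2.2.2
  have hu : ∀ n, _ := fun n ↦ hH n (u n) (hdiam n)
  have huW : ∀ n, ∀ x ∈ Wᶜ, u n x = h₀ x := by
    intro n x hx
    induction n with
    | zero => rfl
    | succ n ih => exact ((hu n).1 x hx).trans ih
  let f : ℕ → C(X, X) := fun n ↦ ⟨u n, (u n).continuous⟩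
  let g : ℕ → C(X, Y) := fun n ↦ ⟨fun x ↦ π ((u n).symm x), hπ.comp (u n).symm.continuous⟩
  have hf : CauchySeq f := cauchySeq_of_le_geometric_two fun n ↦
    (ContinuousMap.dist_le (by positivity)).2 (hu n).2.1
  have hg : CauchySeq g := cauchySeq_of_le_geometric_two fun n ↦
    (ContinuousMap.dist_le (by positivity)).2 (hu n).2.2.1
  obtain ⟨F, hF⟩ := cauchySeq_tendsto_of_complete hf
  obtain ⟨ψ, hψ⟩ := cauchySeq_tendsto_of_complete hg
  have hFx : ∀ x, Filter.Tendsto (fun n ↦ u n x) Filter.atTop (nhds (F x)) := fun x ↦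
    ((continuous_eval_const (F := C(X, X)) x).tendsto F).comp hF
  have hψF : ∀ x, ψ (F x) = π x := by
    intro x
    have h1 : Filter.Tendsto (fun n ↦ g n (u n x)) Filter.atTop (nhds (ψ (F x))) :=
      hψ.eval (hFx x)
    have h2 : ∀ n, g n (u n x) = π x := fun n ↦ by simp [g]
    simp only [h2] at h1
    exact tendsto_nhds_unique h1 tendsto_const_nhds
  have hFsurj : Surjective F := by
    intro y
    rw [← mem_range, ← (isCompact_range F.continuous).isClosed.closure_eq, Metric.mem_closure_iff]
    intro ε hε
    obtain ⟨n, hn⟩ := (Metric.tendsto_nhds.1 hF ε hε).exists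
    refine ⟨F ((u n).symm y), mem_range_self _, ?_⟩
    have := (ContinuousMap.dist_apply_le_dist (f := f n) (g := F) ((u n).symm y)).trans_lt hn
    simpa [f] using this
  have hFB : ∀ x ∈ B, ∀ y ∈ B, F x = F y := by
    intro x hx y hy
    have h1 := (hFx x).dist (hFx y)
    have h2 : Filter.Tendsto (fun n : ℕ ↦ c / 2 / 2 ^ n) Filter.atTop (nhds 0) := by
      simpa [div_eq_mul_inv] using
        (tendsto_pow_atTop_nhds_zero_of_lt_one (r := (2 : ℝ)⁻¹) (by norm_num)
          (by norm_num)).const_mul (c / 2)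
    refine dist_le_zero.1 (le_of_tendsto_of_tendsto' h1 h2 fun n ↦ ?_)
    exact (dist_le_diam_of_mem (hB.1.image (u n).continuous).isBounded
      (mem_image_of_mem _ hx) (mem_image_of_mem _ hy)).trans (hdiam n).le
  have hψbij : Bijective ψ := by
    constructor
    · intro a b hab
      obtain ⟨x, rfl⟩ := hFsurj a
      obtain ⟨y, rfl⟩ := hFsurj b
      rw [hψF, hψF, hfib] at hab
      rcases hab with rfl | ⟨hx, hy⟩
      · rfl
      · exact hFB x hx y hy
    · intro y
      obtain ⟨x, rfl⟩ := hsurj y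
      exact ⟨F x, hψF x⟩
  let Φ : X ≃ₜ Y := Continuous.homeoOfEquivCompactToT2 (f := Equiv.ofBijective ψ hψbij)
    ψ.continuous
  have hΦF : ∀ x, Φ.symm (π x) = F x := fun x ↦ Φ.symm_apply_eq.2 (hψF x).symm
  refine ⟨Φ, fun η hη ↦ ?_⟩
  obtain ⟨n, hn⟩ := (Metric.tendsto_nhds.1 hF η hη).exists
  refine ⟨u n, huW n, fun x ↦ ?_⟩
  rw [hΦF, dist_comm]
  exact (ContinuousMap.dist_apply_le_dist (f := f n) (g := F) x).trans_lt hn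

end Squash

/-- The image of a null collection under a continuous map from a compact space is null. -/
theorem IsNullCollection.image {X : Type u} {Y : Type v} [MetricSpace X]
    [CompactSpace X] [PseudoMetricSpace Y] {π : X → Y} (hπ : Continuous π)
    {𝒢 : Set (Set X)} (hnull : IsNullCollection 𝒢) : IsNullCollection (Set.image π '' 𝒢) := by
  intro ε hε
  obtain ⟨ρ, hρ, hρπ⟩ := Metric.uniformContinuous_iff.1
    (CompactSpace.uniformContinuous_of_continuous hπ) (ε / 2) (by positivity)
  refine ((hnull ρ hρ).image (Set.image π)).subset ?_
  rintro _ ⟨⟨G, hG, rfl⟩, hd⟩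
  refine ⟨G, ⟨hG, ?_⟩, rfl⟩
  by_contra! hlt
  refine absurd hd (not_le.2 ((diam_le_of_forall_dist_le (C := ε / 2) (by positivity) ?_).trans_lt
    (half_lt_self hε)))
  rintro _ ⟨x, hx, rfl⟩ _ ⟨y, hy, rfl⟩
  exact (hρπ ((dist_le_diam_of_mem (isCompact_univ.isBounded.subset (subset_univ G))
    hx hy).trans_lt hlt)).le

/-- If `B ⊆ A` is squeezable in `X` and `A/B` is squeezable in `X/B`, then `A` is squeezable
in `X`. -/
theorem Squeezable.of_squeezableInQuotient {X : Type u} [MetricSpace X] [CompactSpace X]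
    {A B : Set X} (hAc : IsCompact A) (hB : Squeezable B) (hBA : B ⊆ A)
    (hAB : SqueezableInQuotient B A) : Squeezable A := by
  obtain ⟨Y, mY, π, hπ, hsurj, hfib, hπA⟩ := hAB
  have hY : CompactSpace Y := hsurj.compactSpace hπ
  refine ⟨hAc, fun 𝒢 h𝒢 hnull hA U hU hAU δ hδ ↦ ?_⟩
  obtain ⟨hcpt, hpart, -⟩ := h𝒢
  have hδ8 : 0 < δ / 8 := by positivity
  obtain ⟨h₀, h₀U, h₀B, h₀G⟩ := hB.exists_homeomorph_of_subset hBA hcpt hpart hnull hA hU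
    (hBA.trans hAU) hδ8
  obtain ⟨V, hV, hBV, hVd⟩ := hB.1.exists_isOpen_superset_dist_image_le h₀.continuous h₀B
  set T : Set X := ⋃ G ∈ {G | G ∈ 𝒢 ∧ δ / 8 ≤ diam G} \ {A}, G
  have hTc : IsClosed T :=
    (hnull _ hδ8).sdiff.isClosed_biUnion fun G hG ↦ (hcpt G hG.1.1).1.isClosed
  have hTA : ∀ x ∈ T, x ∉ A := by
    intro x hx hxA
    obtain ⟨G, hG, hxG⟩ := mem_iUnion₂.1 hx
    exact hG.2 ((hpart x).unique ⟨hG.1.1, hxG⟩ ⟨hA, hxA⟩)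
  obtain ⟨Φ, hΦ⟩ := hB.exists_homeomorph_quotient hπ hsurj hfib
    ((hU.inter hV).inter hTc.isOpen_compl) (W := U ∩ V ∩ Tᶜ)
    (fun x hx ↦ ⟨⟨hAU (hBA hx), hBV hx⟩, fun hxT ↦ hTA x hxT (hBA hx)⟩) h₀
  set W := U ∩ V ∩ Tᶜ
  have hFh₀ : ∀ x, dist (Φ.symm (π x)) (h₀ x) ≤ δ / 8 := by
    refine fun x ↦ le_of_forall_pos_le_add fun η hη ↦ ?_
    obtain ⟨k, hkW, hk⟩ := hΦ η hη
    have hkh₀ : dist (k x) (h₀ x) ≤ δ / 8 := by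
      by_cases hx : x ∈ W
      · have hs : ∀ z ∈ Wᶜ, (k.trans h₀.symm) z = z := fun z hz ↦
          h₀.symm_apply_eq.2 (hkW z hz)
        have := hVd _ (Homeomorph.apply_mem_of_forall_compl hs hx).1.2 _ hx.1.2
        simpa using this
      · simp [hkW x hx, hδ8.le]
    linarith [dist_triangle (Φ.symm (π x)) (k x) (h₀ x), hk x]
  have hFW : ∀ x ∈ Wᶜ, Φ.symm (π x) = h₀ x := by
    refine fun x hx ↦ dist_le_zero.1 (le_of_forall_pos_le_add fun η hη ↦ ?_)
    obtain ⟨k, hkW, hk⟩ := hΦ η hη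
    rw [← hkW x hx, zero_add]
    exact (hk x).le
  have hFU : ∀ x ∈ Uᶜ, Φ.symm (π x) = x := fun x hx ↦
    (hFW x fun hx' ↦ hx hx'.1.1).trans (h₀U x hx)
  have hAO : π '' A ⊆ Φ.symm ⁻¹' U := by
    rintro _ ⟨x, hx, rfl⟩
    by_contra hxU
    have h1 := Φ.symm.injective (hFU _ hxU)
    rcases (hfib _ _).1 h1 with h2 | h2
    · exact hxU (by rw [mem_preimage, h2]; exact hAU hx)
    · exact hxU (hAU (hBA h2.1))
  obtain ⟨ρ, hρ, hρΦ⟩ := Metric.uniformContinuous_iff.1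
    (CompactSpace.uniformContinuous_of_continuous Φ.symm.continuous) (δ / 8) hδ8
  have hnull' : IsNullCollection (Set.image π '' 𝒢) := hnull.image hπ
  have hdec : IsUSCDecomposition (image π '' 𝒢) := by
    refine hnull'.isUSCDecomposition ?_ fun y ↦ ?_
    · rintro _ ⟨G, hG, rfl⟩
      exact ⟨(hcpt G hG).1.image hπ, (hcpt G hG).2.image π⟩
    · obtain ⟨x, rfl⟩ := hsurj y
      obtain ⟨G, ⟨hG, hxG⟩, huniq⟩ := hpart x
      refine ⟨π '' G, ⟨mem_image_of_mem _ hG, mem_image_of_mem _ hxG⟩, ?_⟩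
      rintro _ ⟨⟨G', hG', rfl⟩, x', hx', hxx'⟩
      rcases (hfib _ _).1 hxx' with rfl | ⟨h1, h2⟩
      · rw [huniq G' ⟨hG', hx'⟩]
      · rw [(hpart x').unique ⟨hG', hx'⟩ ⟨hA, hBA h1⟩, huniq A ⟨hA, hBA h2⟩]
  obtain ⟨g, hgO, hgA, hgG⟩ := hπA.2 _ hdec hnull' (mem_image_of_mem _ hA) (Φ.symm ⁻¹' U)
    (hU.preimage Φ.symm.continuous) hAO ρ hρ
  let q : X ≃ₜ X := (Φ.trans g).trans Φ.symm
  obtain ⟨η, hη, hηq⟩ := Metric.uniformContinuous_iff.1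
    (CompactSpace.uniformContinuous_of_continuous q.continuous) (δ / 8) hδ8
  obtain ⟨k, hkW, hk⟩ := hΦ η hη
  have hqF : ∀ x, q (Φ.symm (π x)) = Φ.symm (g (π x)) := fun x ↦ by simp [q]
  have hsmall : ∀ S : Set X, (∀ x ∈ S, ∀ y ∈ S,
      dist (Φ.symm (g (π x))) (Φ.symm (g (π y))) ≤ 3 * (δ / 8)) →
      diam ((k.trans q) '' S) < δ := by
    intro S hS
    refine (diam_le_of_forall_dist_le (C := 5 * (δ / 8)) (by positivity) ?_).trans_lt (by linarith)
    rintro _ ⟨x, hx, rfl⟩ _ ⟨y, hy, rfl⟩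
    have h1 := hηq (hk x)
    have h2 := hηq (hk y)
    have h3 := hS x hx y hy
    rw [hqF] at h1 h2
    rw [dist_comm] at h1
    change dist (q (k x)) (q (k y)) ≤ _
    linarith [dist_triangle4 (q (k x)) (Φ.symm (g (π x))) (Φ.symm (g (π y))) (q (k y))]
  have hsmall' : ∀ S : Set X, diam (g '' (π '' S)) < ρ → diam ((k.trans q) '' S) < δ := by
    refine fun S hS ↦ hsmall S fun x hx y hy ↦ ?_
    have := hρΦ ((dist_le_diam_of_mem (isCompact_univ.isBounded.subset (subset_univ _))
      (mem_image_of_mem g (mem_image_of_mem π hx))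
      (mem_image_of_mem g (mem_image_of_mem π hy))).trans_lt hS)
    linarith
  refine ⟨k.trans q, fun x hx ↦ ?_, hsmall' A hgA, fun G hG ↦ ?_⟩
  · have h1 : k x = x := (hkW x fun hx' ↦ hx hx'.1.1).trans (h₀U x hx)
    have h2 : g (Φ x) = Φ x := hgO _ (by simpa using hx)
    simp [q, h1, h2]
  · by_cases hGA : G = A
    · exact Or.inl (hGA ▸ hsmall' A hgA)
    rcases hgG _ (mem_image_of_mem _ hG) with hG1 | hG1
    · exact Or.inl (hsmall' G hG1)
    have hgπ : ∀ x ∈ G, g (π x) = π x := fun x hx ↦ hG1 _ (mem_image_of_mem π hx)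
    have hsmall'' : diam (h₀ '' G) < δ / 8 → diam ((k.trans q) '' G) < δ := by
      refine fun hd ↦ hsmall G fun x hx y hy ↦ ?_
      rw [hgπ x hx, hgπ y hy]
      have h1 := dist_le_diam_of_mem (isCompact_univ.isBounded.subset (subset_univ _))
        (mem_image_of_mem h₀ hx) (mem_image_of_mem h₀ hy)
      have h2 := hFh₀ x
      have h3 := hFh₀ y
      rw [dist_comm] at h3
      linarith [dist_triangle4 (Φ.symm (π x)) (h₀ x) (h₀ y) (Φ.symm (π y))]
    rcases h₀G G hG hGA with hd | hid
    · exact Or.inl (hsmall'' hd)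
    rcases lt_or_ge (diam G) (δ / 8) with hd | hd
    · refine Or.inl (hsmall'' ?_)
      rwa [image_congr hid, image_id']
    · refine Or.inr fun x hx ↦ ?_
      have hxW : x ∈ Wᶜ := fun hxW ↦ hxW.2 (mem_iUnion₂.2 ⟨G, ⟨⟨hG, hd⟩, hGA⟩, hx⟩)
      have h1 : Φ.symm (π x) = x := (hFW x hxW).trans (hid x hx)
      have h2 := hqF x
      rw [hgπ x hx, h1] at h2
      change q (k x) = x
      rw [hkW x hxW, hid x hx, h2]

/-- **Main theorem:** every recursively squeezable subset of a compact metrizable space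
is squeezable. -/
theorem recursivelySqueezable_imp_squeezable {X : Type u} [MetricSpace X] [CompactSpace X]
    (A : Set X) (hA : RecursivelySqueezable A) : Squeezable A := by
  obtain ⟨n, F, hcpt, hmono, rfl, h0, hstep⟩ := hA
  exact Fin.induction (motive := fun i ↦ Squeezable (F i)) h0
    (fun i hi ↦ hi.of_squeezableInQuotient (hcpt _) (hmono (Fin.castSucc_lt_succ).le) (hstep i))
    (Fin.last n)
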